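/- Let U_P be a pattern group and let u ∈ U_P satisfy u − 1 = s + t, where s and t are strictly upper triangular matrices such that no row index carries nonzero entries of both s and t and no column index carries nonzero entries of both s and t (so 1+s, 1+t ∈ U_P). Then for every λ ∈ 𝔫_P*: χ^λ(u) · χ^λ(1) = χ^λ(1+s) · χ^λ(1+t). -/

import Mathlib

open Matrix BigOperators
open scoped Classical

/-- `n × n` matrices over `F`. -/
abbrev Mat (n : ℕ) (F : Type*) := Matrix (Fin n) (Fin n) F

section Defs

variable {n : ℕ} {F : Type*} [Field F] [Fintype F]

/-- The pattern group `U_P` attached to a relation `P` on `{0,…,n-1}`: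
unipotent upper-triangular matrices supported (off the diagonal) on positions `(i,j)` with `P i j`. -/
def patGroup (P : Fin n → Fin n → Prop) : Set (Mat n F) :=
  {u | (∀ i, u i i = 1) ∧ ∀ i j, i ≠ j → ¬ P i j → u i j = 0}

/-- Truncation of a matrix to the positions allowed by `P` (used to identify a functional on
`𝔫_P` with the matrix of its coefficients on allowable positions). -/
noncomputable def truncP (P : Fin n → Fin n → Prop) (A : Mat n F) : Mat n F :=
  Matrix.of fun i j => if P i j then A i j else 0

/-- The left orbit `U_P λ` of the functional (identified with a matrix) `lam`:
`(aλ)(x) = λ(a⁻¹ x)`, whose coefficient matrix is the truncation of `(a⁻¹)ᵀ * λ`. -/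
noncomputable def dualLeftOrbit (P : Fin n → Fin n → Prop) (lam : Mat n F) : Set (Mat n F) :=
  {mu | ∃ a ∈ (patGroup P : Set (Mat n F)), mu = truncP P ((a⁻¹)ᵀ * lam)}

/-- The two-sided orbit `U_P λ U_P` of the functional `lam`: `(aλb)(x) = λ(a⁻¹ x b⁻¹)`,
whose coefficient matrix is the truncation of `(a⁻¹)ᵀ * λ * (b⁻¹)ᵀ`. -/
noncomputable def dualOrbit (P : Fin n → Fin n → Prop) (lam : Mat n F) : Set (Mat n F) :=
  {mu | ∃ a ∈ (patGroup P : Set (Mat n F)), ∃ b ∈ (patGroup P : Set (Mat n F)),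
    mu = truncP P ((a⁻¹)ᵀ * lam * (b⁻¹)ᵀ)}

/-- The two-sided superclass orbit `{a (v-1) b : a, b ∈ U_P}` attached to `v ∈ U_P`. -/
def classOrbit (P : Fin n → Fin n → Prop) (v : Mat n F) : Set (Mat n F) :=
  {x | ∃ a ∈ (patGroup P : Set (Mat n F)), ∃ b ∈ (patGroup P : Set (Mat n F)),
    x = a * (v - 1) * b}

/-- The pairing `λ(x) = Σ_{i,j} λ_{ij} x_{ij}` of a functional-matrix with a matrix. -/
def pairM (A B : Mat n F) : F := ∑ i, ∑ j, A i j * B i j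

/-- The supercharacter `χ^λ` of the pattern group `U_P` attached to the functional `lam`:
`χ^λ(u) = (|U_Pλ|/|U_PλU_P|) Σ_{μ ∈ U_PλU_P} θ(−μ(u−1))`. -/
noncomputable def superChar (P : Fin n → Fin n → Prop) (θ : AddChar F ℂ)
    (lam u : Mat n F) : ℂ :=
  ((dualLeftOrbit P lam).ncard : ℂ) / ((dualOrbit P lam).ncard : ℂ) *
    ∑ᶠ mu ∈ dualOrbit P lam, θ (- pairM mu (u - 1))

/-- The full order `i < j`, whose pattern group is `U_n`. -/
def Plt (n : ℕ) : Fin n → Fin n → Prop := fun i j => i < j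

/-- The poset `𝒫_(m)` (in 0-based indexing): `i < j`, except that row `0` (row `1` in 1-based
indexing) is only comparable to columns `j` with 1-based value `j+1 > m`.  Its pattern group is
the interpolating group `U_(m)`. -/
def Pm (n m : ℕ) : Fin n → Fin n → Prop := fun i j => i < j ∧ (i.val = 0 → m < j.val + 1)

/-- `𝒮_n(q)`: strictly upper-triangular matrices with at most one nonzero entry in each row
and each column. -/
def Sset (n : ℕ) (F : Type*) [Field F] : Set (Mat n F) :=
  {lam | (∀ i j : Fin n, ¬ i < j → lam i j = 0) ∧
    (∀ (i j j' : Fin n), lam i j ≠ 0 → lam i j' ≠ 0 → j = j') ∧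
    (∀ (i i' j : Fin n), lam i j ≠ 0 → lam i' j ≠ 0 → i = i')}

/-- Adjacency of two nonzero positions of `A` (they share a row or a column): the edges of
the graph `G_A`. -/
def adjRel (A : Mat n F) (p q : Fin n × Fin n) : Prop :=
  p ≠ q ∧ A p.1 p.2 ≠ 0 ∧ A q.1 q.2 ≠ 0 ∧ (p.1 = q.1 ∨ p.2 = q.2)

/-- The connected component of the position `p` in the graph `G_A`. -/
def compOf (A : Mat n F) (p : Fin n × Fin n) : Set (Fin n × Fin n) :=
  {q | Relation.ReflTransGen (adjRel A) p q}

/-- The set of connected components of the graph `G_A`. -/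
def comps (A : Mat n F) : Set (Set (Fin n × Fin n)) :=
  {S | ∃ p : Fin n × Fin n, A p.1 p.2 ≠ 0 ∧ S = compOf A p}

/-- The matrix agreeing with `A` on the positions of `S` and vanishing elsewhere. -/
noncomputable def restrictTo (S : Set (Fin n × Fin n)) (A : Mat n F) : Mat n F :=
  Matrix.of fun i j => if (i, j) ∈ S then A i j else 0

/-- At most one connected component of `G_A` has more than one vertex. -/
def AtMostOneBig (A : Mat n F) : Prop :=
  ∀ p q : Fin n × Fin n, A p.1 p.2 ≠ 0 → A q.1 q.2 ≠ 0 →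
    1 < (compOf A p).ncard → 1 < (compOf A q).ncard → compOf A p = compOf A q

end Defs

section PatternGroup

variable {n : ℕ} {F : Type*} [Field F] {P : Fin n → Fin n → Prop}

theorem one_mem_patGroup : (1 : Mat n F) ∈ patGroup P :=
  ⟨fun _ => Matrix.one_apply_eq _, fun _ _ hij _ => Matrix.one_apply_ne hij⟩

/-- The support condition defining `patGroup`, in terms of the reflexive closure of `P`. -/
theorem apply_eq_zero_of_mem_patGroup {a : Mat n F} (ha : a ∈ patGroup P) {i j : Fin n}
    (h : ¬ (i = j ∨ P i j)) : a i j = 0 :=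
  ha.2 i j (fun e => h (Or.inl e)) (fun e => h (Or.inr e))

theorem mul_mem_patGroup (hP1 : ∀ i j : Fin n, P i j → i < j)
    (hP2 : ∀ i j k : Fin n, P i j → P j k → P i k) {a b : Mat n F}
    (ha : a ∈ patGroup P) (hb : b ∈ patGroup P) : a * b ∈ patGroup P := by
  refine ⟨fun i => ?_, fun i j hij hPij => ?_⟩
  · rw [Matrix.mul_apply, Finset.sum_eq_single i, ha.1, hb.1, one_mul]
    · intro k _ hk
      by_cases h : P i k
      · rw [hb.2 k i hk fun h' => (hP1 _ _ h).not_gt (hP1 _ _ h'), mul_zero]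
      · rw [ha.2 i k hk.symm h, zero_mul]
    · simp
  · rw [Matrix.mul_apply]
    refine Finset.sum_eq_zero fun k _ => ?_
    by_cases h : i = k ∨ P i k
    · rw [apply_eq_zero_of_mem_patGroup hb, mul_zero]
      rintro (rfl | h')
      · exact h.elim hij hPij
      · rcases h with rfl | h
        · exact hPij h'
        · exact hPij (hP2 _ _ _ h h')
    · rw [apply_eq_zero_of_mem_patGroup ha h, zero_mul]

theorem det_eq_one_of_mem_patGroup (hP1 : ∀ i j : Fin n, P i j → i < j) {a : Mat n F}
    (ha : a ∈ patGroup P) : a.det = 1 := by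
  rw [Matrix.det_of_isUpperTriangular]
  · exact Finset.prod_eq_one fun i _ => ha.1 i
  · intro i j hij
    exact ha.2 i j (ne_of_gt hij) fun h => (hP1 _ _ h).not_gt hij

theorem inv_mem_patGroup [Finite F] (hP1 : ∀ i j : Fin n, P i j → i < j)
    (hP2 : ∀ i j k : Fin n, P i j → P j k → P i k) {a : Mat n F}
    (ha : a ∈ patGroup P) : a⁻¹ ∈ patGroup P := by
  have hunit : IsUnit a := by
    rw [Matrix.isUnit_iff_isUnit_det, det_eq_one_of_mem_patGroup hP1 ha]
    exact isUnit_one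
  obtain ⟨v, rfl⟩ := hunit
  obtain ⟨m, hm, hv⟩ := isOfFinOrder_iff_pow_eq_one.1 (isOfFinOrder_of_finite v)
  have hpow : ∀ k : ℕ, (v : Mat n F) ^ k ∈ patGroup P := fun k => by
    induction k with
    | zero => rw [pow_zero]; exact one_mem_patGroup
    | succ k ih => rw [pow_succ]; exact mul_mem_patGroup hP1 hP2 ih ha
  have hinv : (v : Mat n F)⁻¹ = (v : Mat n F) ^ (m - 1) := by
    apply Matrix.inv_eq_right_inv
    rw [← pow_succ', Nat.sub_add_cancel hm, ← Units.val_pow_eq_pow_val, hv, Units.val_one]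
  rw [hinv]
  exact hpow _

theorem mul_apply_eq_zero_of_mem_patGroup (hP2 : ∀ i j k : Fin n, P i j → P j k → P i k)
    {a b x : Mat n F} (ha : a ∈ patGroup P) (hb : b ∈ patGroup P)
    (hx : ∀ i j : Fin n, ¬ P i j → x i j = 0) (i j : Fin n) (hij : ¬ P i j) :
    (a * x * b) i j = 0 := by
  rw [Matrix.mul_apply]
  refine Finset.sum_eq_zero fun l _ => ?_
  by_cases hl : l = j ∨ P l j
  · rw [Matrix.mul_apply, Finset.sum_eq_zero, zero_mul]
    intro k _
    by_cases hk : i = k ∨ P i k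
    · rw [hx, mul_zero]
      intro h
      apply hij
      have hil : P i l := by
        rcases hk with rfl | hk
        · exact h
        · exact hP2 _ _ _ hk h
      rcases hl with rfl | hl
      · exact hil
      · exact hP2 _ _ _ hil hl
    · rw [apply_eq_zero_of_mem_patGroup ha hk, zero_mul]
  · rw [apply_eq_zero_of_mem_patGroup hb hl, mul_zero]

theorem pairM_eq_trace (A B : Mat n F) : pairM A B = (Aᵀ * B).trace := by
  simp only [pairM, Matrix.trace, Matrix.diag, Matrix.mul_apply, Matrix.transpose_apply]
  exact Finset.sum_comm

theorem pairM_add (A B C : Mat n F) : pairM A (B + C) = pairM A B + pairM A C := by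
  simp only [pairM_eq_trace, mul_add, Matrix.trace_add]

theorem pairM_truncP (A x : Mat n F) (hx : ∀ i j : Fin n, ¬ P i j → x i j = 0) :
    pairM (truncP P A) x = pairM A x := by
  refine Finset.sum_congr rfl fun i _ => Finset.sum_congr rfl fun j _ => ?_
  by_cases h : P i j
  · simp [truncP, h]
  · simp [hx i j h]

theorem pairM_single (A : Mat n F) (i j : Fin n) : pairM A (Matrix.single i j 1) = A i j := by
  rw [pairM_eq_trace, Matrix.trace_mul_single]
  simp

/-- The functional `x ↦ λ(a x b)`, as a matrix supported on the positions allowed by `P`. -/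
noncomputable def dualTranslate (P : Fin n → Fin n → Prop) (lam : Mat n F)
    (p : Mat n F × Mat n F) : Mat n F :=
  truncP P (p.1ᵀ * lam * p.2ᵀ)

theorem pairM_dualTranslate (lam : Mat n F) (p : Mat n F × Mat n F) {x : Mat n F}
    (hx : ∀ i j : Fin n, ¬ P i j → x i j = 0) :
    pairM (dualTranslate P lam p) x = pairM lam (p.1 * x * p.2) := by
  rw [dualTranslate, pairM_truncP _ _ hx, pairM_eq_trace, pairM_eq_trace]
  simp only [Matrix.transpose_mul, Matrix.transpose_transpose]
  rw [mul_assoc, Matrix.trace_mul_comm]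
  simp only [mul_assoc]

theorem dualTranslate_eq_iff (lam : Mat n F) (p q : Mat n F × Mat n F) :
    dualTranslate P lam p = dualTranslate P lam q ↔
      ∀ x : Mat n F, (∀ i j : Fin n, ¬ P i j → x i j = 0) →
        pairM lam (p.1 * x * p.2) = pairM lam (q.1 * x * q.2) := by
  refine ⟨fun h x hx => ?_, fun h => ?_⟩
  · rw [← pairM_dualTranslate lam p hx, ← pairM_dualTranslate lam q hx, h]
  · ext i j
    by_cases hij : P i j
    · have hx : ∀ k l : Fin n, ¬ P k l → (Matrix.single i j 1 : Mat n F) k l = 0 := by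
        intro k l hkl
        refine Matrix.single_apply_of_ne _ _ _ _ _ ?_
        rintro ⟨rfl, rfl⟩
        exact hkl hij
      rw [← pairM_single (dualTranslate P lam p), ← pairM_single (dualTranslate P lam q),
        pairM_dualTranslate lam p hx, pairM_dualTranslate lam q hx, h _ hx]
    · simp [dualTranslate, truncP, hij]

theorem dualTranslate_mul_eq (hP2 : ∀ i j k : Fin n, P i j → P j k → P i k) (lam : Mat n F)
    {p q : Mat n F × Mat n F} {a b : Mat n F} (ha : a ∈ patGroup P) (hb : b ∈ patGroup P)
    (h : dualTranslate P lam p = dualTranslate P lam q) :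
    dualTranslate P lam (p.1 * a, b * p.2) = dualTranslate P lam (q.1 * a, b * q.2) := by
  rw [dualTranslate_eq_iff] at h ⊢
  intro x hx
  have := h (a * x * b) (mul_apply_eq_zero_of_mem_patGroup hP2 ha hb hx)
  simpa only [mul_assoc] using this

/-- The columns of `a` indexed by `R`, and the remaining columns of `b`. -/
noncomputable def mixCols (R : Set (Fin n)) (a b : Mat n F) : Mat n F :=
  Matrix.of fun i j => if j ∈ R then a i j else b i j

/-- The rows of `a` indexed by `R`, and the remaining rows of `b`. -/
noncomputable def mixRows (R : Set (Fin n)) (a b : Mat n F) : Mat n F :=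
  Matrix.of fun i j => if i ∈ R then a i j else b i j

theorem mixCols_mem_patGroup (R : Set (Fin n)) {a b : Mat n F} (ha : a ∈ patGroup P)
    (hb : b ∈ patGroup P) : mixCols R a b ∈ patGroup P := by
  refine ⟨fun i => ?_, fun i j hij h => ?_⟩
  · simp [mixCols, ha.1, hb.1]
  · simp [mixCols, ha.2 i j hij h, hb.2 i j hij h]

theorem mixRows_mem_patGroup (R : Set (Fin n)) {a b : Mat n F} (ha : a ∈ patGroup P)
    (hb : b ∈ patGroup P) : mixRows R a b ∈ patGroup P := by
  refine ⟨fun i => ?_, fun i j hij h => ?_⟩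
  · simp [mixRows, ha.1, hb.1]
  · simp [mixRows, ha.2 i j hij h, hb.2 i j hij h]

theorem mixCols_mixCols {α : Type*} (R : Set (Fin n)) (a b : Mat n α) :
    mixCols R (mixCols R a b) (mixCols R b a) = a := by
  ext i j
  by_cases h : j ∈ R <;> simp [mixCols, h]

theorem mixRows_mixRows {α : Type*} (R : Set (Fin n)) (a b : Mat n α) :
    mixRows R (mixRows R a b) (mixRows R b a) = a := by
  ext i j
  by_cases h : i ∈ R <;> simp [mixRows, h]

theorem mixCols_mul_left (R : Set (Fin n)) (a b x : Mat n F)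
    (hx : ∀ i ∉ R, ∀ j, x i j = 0) : mixCols R a b * x = a * x := by
  ext i j
  simp only [Matrix.mul_apply]
  refine Finset.sum_congr rfl fun k _ => ?_
  by_cases h : k ∈ R
  · simp [mixCols, h]
  · simp [hx k h]

theorem mixCols_mul_right (R : Set (Fin n)) (a b x : Mat n F)
    (hx : ∀ i ∈ R, ∀ j, x i j = 0) : mixCols R a b * x = b * x := by
  ext i j
  simp only [Matrix.mul_apply]
  refine Finset.sum_congr rfl fun k _ => ?_
  by_cases h : k ∈ R
  · simp [hx k h]
  · simp [mixCols, h]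

theorem mul_mixRows_left (R : Set (Fin n)) (a b x : Mat n F)
    (hx : ∀ j ∉ R, ∀ i, x i j = 0) : x * mixRows R a b = x * a := by
  ext i j
  simp only [Matrix.mul_apply]
  refine Finset.sum_congr rfl fun k _ => ?_
  by_cases h : k ∈ R
  · simp [mixRows, h]
  · simp [hx k h]

theorem mul_mixRows_right (R : Set (Fin n)) (a b x : Mat n F)
    (hx : ∀ j ∈ R, ∀ i, x i j = 0) : x * mixRows R a b = x * b := by
  ext i j
  simp only [Matrix.mul_apply]
  refine Finset.sum_congr rfl fun k _ => ?_
  by_cases h : k ∈ R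
  · simp [hx k h]
  · simp [mixRows, h]

variable [Fintype F]

/-- The finite set of pairs of elements of the pattern group. -/
noncomputable def patPairs (P : Fin n → Fin n → Prop) : Finset (Mat n F × Mat n F) :=
  {p | p.1 ∈ patGroup P ∧ p.2 ∈ patGroup P}

theorem mem_patPairs {p : Mat n F × Mat n F} :
    p ∈ patPairs P ↔ p.1 ∈ patGroup P ∧ p.2 ∈ patGroup P := by
  simp [patPairs]

/-- The sum of `θ(-λ(a x b))` over all `a, b` in the pattern group. -/
noncomputable def patSum (P : Fin n → Fin n → Prop) (θ : AddChar F ℂ) (lam x : Mat n F) : ℂ :=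
  ∑ p ∈ patPairs P, θ (- pairM lam (p.1 * x * p.2))

theorem coe_image_dualTranslate (hP1 : ∀ i j : Fin n, P i j → i < j)
    (hP2 : ∀ i j k : Fin n, P i j → P j k → P i k) (lam : Mat n F) :
    (((patPairs P).image (dualTranslate P lam) : Finset (Mat n F)) : Set (Mat n F)) =
      dualOrbit P lam := by
  ext mu
  simp only [Finset.coe_image, Set.mem_image, Finset.mem_coe, mem_patPairs, dualOrbit,
    Set.mem_ofPred_eq]
  constructor
  · rintro ⟨p, ⟨ha, hb⟩, rfl⟩
    refine ⟨p.1⁻¹, inv_mem_patGroup hP1 hP2 ha, p.2⁻¹, inv_mem_patGroup hP1 hP2 hb, ?_⟩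
    rw [Matrix.nonsing_inv_nonsing_inv, Matrix.nonsing_inv_nonsing_inv, dualTranslate]
    · rw [det_eq_one_of_mem_patGroup hP1 hb]; exact isUnit_one
    · rw [det_eq_one_of_mem_patGroup hP1 ha]; exact isUnit_one
  · rintro ⟨a, ha, b, hb, rfl⟩
    exact ⟨(a⁻¹, b⁻¹), ⟨inv_mem_patGroup hP1 hP2 ha, inv_mem_patGroup hP1 hP2 hb⟩, rfl⟩

/-- All fibers of the orbit map have the size of the fiber over the base point. -/
theorem card_fiber_dualTranslate (hP1 : ∀ i j : Fin n, P i j → i < j)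
    (hP2 : ∀ i j k : Fin n, P i j → P j k → P i k) (lam : Mat n F)
    {r : Mat n F × Mat n F} (hr : r ∈ patPairs P) :
    ((patPairs P).filter fun p => dualTranslate P lam p = dualTranslate P lam r).card =
      ((patPairs P).filter fun p => dualTranslate P lam p = dualTranslate P lam (1, 1)).card := by
  rw [mem_patPairs] at hr
  obtain ⟨ha, hb⟩ := hr
  have ha' := inv_mem_patGroup hP1 hP2 ha
  have hb' := inv_mem_patGroup hP1 hP2 hb
  have hda : IsUnit r.1.det := by rw [det_eq_one_of_mem_patGroup hP1 ha]; exact isUnit_one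
  have hdb : IsUnit r.2.det := by rw [det_eq_one_of_mem_patGroup hP1 hb]; exact isUnit_one
  refine Finset.card_bij' (fun p _ => (p.1 * r.1⁻¹, r.2⁻¹ * p.2))
    (fun p _ => (p.1 * r.1, r.2 * p.2)) ?_ ?_ ?_ ?_
  · intro p hp
    simp only [Finset.mem_filter, mem_patPairs] at hp ⊢
    refine ⟨⟨mul_mem_patGroup hP1 hP2 hp.1.1 ha', mul_mem_patGroup hP1 hP2 hb' hp.1.2⟩, ?_⟩
    rw [dualTranslate_mul_eq hP2 lam ha' hb' hp.2, Matrix.mul_nonsing_inv _ hda,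
      Matrix.nonsing_inv_mul _ hdb]
  · intro p hp
    simp only [Finset.mem_filter, mem_patPairs] at hp ⊢
    refine ⟨⟨mul_mem_patGroup hP1 hP2 hp.1.1 ha, mul_mem_patGroup hP1 hP2 hb hp.1.2⟩, ?_⟩
    rw [dualTranslate_mul_eq hP2 lam ha hb hp.2, one_mul, mul_one]
  · intro p _
    simp [Matrix.nonsing_inv_mul_cancel_right _ _ hda, Matrix.mul_nonsing_inv_cancel_left _ _ hdb]
  · intro p _
    simp [Matrix.mul_nonsing_inv_cancel_right _ _ hda, Matrix.nonsing_inv_mul_cancel_left _ _ hdb]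

/-- A supercharacter is, up to a factor depending only on `λ`, the sum over the pattern group. -/
theorem exists_superChar_eq_mul_patSum (hP1 : ∀ i j : Fin n, P i j → i < j)
    (hP2 : ∀ i j k : Fin n, P i j → P j k → P i k) (θ : AddChar F ℂ) (lam : Mat n F) :
    ∃ c : ℂ, ∀ u : Mat n F, (∀ i j : Fin n, ¬ P i j → (u - 1) i j = 0) →
      superChar P θ lam u = c * patSum P θ lam (u - 1) := by
  set k : ℕ :=
    ((patPairs P).filter fun p => dualTranslate P lam p = dualTranslate P lam (1, 1)).card
    with hk
  have hk0 : (k : ℂ) ≠ 0 := by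
    rw [Nat.cast_ne_zero, hk]
    exact Finset.card_ne_zero_of_mem (a := (1, 1)) (Finset.mem_filter.2
      ⟨mem_patPairs.2 ⟨one_mem_patGroup, one_mem_patGroup⟩, rfl⟩)
  refine ⟨((dualLeftOrbit P lam).ncard : ℂ) / ((dualOrbit P lam).ncard : ℂ) * (k : ℂ)⁻¹,
    fun u hu => ?_⟩
  have hsum : patSum P θ lam (u - 1) =
      k * ∑ᶠ mu ∈ dualOrbit P lam, θ (- pairM mu (u - 1)) := by
    rw [← coe_image_dualTranslate hP1 hP2, finsum_mem_coe_finset, Finset.mul_sum, patSum]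
    rw [Finset.sum_congr rfl fun p _ => by rw [← pairM_dualTranslate lam p hu]]
    rw [Finset.sum_comp (fun mu => θ (- pairM mu (u - 1))) (dualTranslate P lam)]
    refine Finset.sum_congr rfl fun mu hmu => ?_
    obtain ⟨r, hr, rfl⟩ := Finset.mem_image.1 hmu
    rw [card_fiber_dualTranslate hP1 hP2 lam hr, nsmul_eq_mul]
  rw [superChar, hsum, mul_assoc, inv_mul_cancel_left₀ hk0]

/-- Columns of `a` and rows of `b` are independent, so the sums over the pattern group are
multiplicative on matrices with disjoint row and column supports. -/
theorem patSum_add_mul_patSum_zero (θ : AddChar F ℂ) (lam s t : Mat n F)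
    (hrow : ∀ i : Fin n, (∃ j, s i j ≠ 0) → ∀ j, t i j = 0)
    (hcol : ∀ j : Fin n, (∃ i, s i j ≠ 0) → ∀ i, t i j = 0) :
    patSum P θ lam (s + t) * patSum P θ lam 0 = patSum P θ lam s * patSum P θ lam t := by
  set R : Set (Fin n) := {i | ∃ j, s i j ≠ 0}
  set C : Set (Fin n) := {j | ∃ i, s i j ≠ 0}
  have hsR : ∀ i ∉ R, ∀ j, s i j = 0 := fun i hi j => by
    by_contra h
    exact hi ⟨j, h⟩
  have hsC : ∀ j ∉ C, ∀ i, s i j = 0 := fun j hj i => by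
    by_contra h
    exact hj ⟨i, h⟩
  let swap : (Mat n F × Mat n F) × (Mat n F × Mat n F) →
      (Mat n F × Mat n F) × (Mat n F × Mat n F) := fun z =>
    ((mixCols R z.1.1 z.2.1, mixRows C z.1.2 z.2.2),
      (mixCols R z.2.1 z.1.1, mixRows C z.2.2 z.1.2))
  have hswap : ∀ z, swap (swap z) = z := fun z => by
    simp [swap, mixCols_mixCols, mixRows_mixRows]
  have hmem : ∀ z ∈ patPairs P ×ˢ patPairs P, swap z ∈ patPairs P ×ˢ patPairs P := by
    intro z hz
    simp only [Finset.mem_product, mem_patPairs, swap] at hz ⊢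
    obtain ⟨⟨h1, h2⟩, h3, h4⟩ := hz
    exact ⟨⟨mixCols_mem_patGroup R h1 h3, mixRows_mem_patGroup C h2 h4⟩,
      mixCols_mem_patGroup R h3 h1, mixRows_mem_patGroup C h4 h2⟩
  symm
  simp only [patSum]
  rw [Finset.sum_mul_sum, Finset.sum_mul_sum, ← Finset.sum_product', ← Finset.sum_product']
  refine Finset.sum_bij' (fun z _ => swap z) (fun z _ => swap z) hmem hmem
    (fun z _ => hswap z) (fun z _ => hswap z) fun z _ => ?_
  have h0 : ∀ p : Mat n F × Mat n F, θ (- pairM lam (p.1 * 0 * p.2)) = 1 := fun p => by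
    simp [pairM]
  rw [h0, mul_one, ← AddChar.map_add_eq_mul, ← neg_add, ← pairM_add]
  simp only [swap]
  rw [mul_add, add_mul, mixCols_mul_left R _ _ s hsR, mixCols_mul_right R _ _ t hrow,
    mul_assoc _ s (mixRows _ _ _), mul_mixRows_left C _ _ s hsC,
    mul_assoc _ t (mixRows _ _ _), mul_mixRows_right C _ _ t hcol, ← mul_assoc, ← mul_assoc]

end PatternGroup

/-- If `u ∈ U_P` and `u − 1 = s + t` where `s`, `t` are supported on allowable
positions and share no row and no column of nonzero entries (so `1+s, 1+t ∈ U_P`), then for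
every `λ ∈ 𝔫_P^*`: `χ^λ(u) · χ^λ(1) = χ^λ(1+s) · χ^λ(1+t)`. -/
theorem stmt11 {n : ℕ} {F : Type*} [Field F] [Fintype F]
    (P : Fin n → Fin n → Prop)
    (hP1 : ∀ i j : Fin n, P i j → i < j)
    (hP2 : ∀ i j k : Fin n, P i j → P j k → P i k)
    (θ : AddChar F ℂ) (hθ : ∃ x, θ x ≠ 1)
    (u : Mat n F) (hu : u ∈ patGroup P)
    (s t : Mat n F)
    (hs : ∀ i j : Fin n, ¬ P i j → s i j = 0)
    (ht : ∀ i j : Fin n, ¬ P i j → t i j = 0)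
    (hsum : u - 1 = s + t)
    (hrow : ∀ i : Fin n, (∃ j, s i j ≠ 0) → ∀ j, t i j = 0)
    (hcol : ∀ j : Fin n, (∃ i, s i j ≠ 0) → ∀ i, t i j = 0) :
    ∀ lam : Mat n F, (∀ i j : Fin n, ¬ P i j → lam i j = 0) →
      superChar P θ lam u * superChar P θ lam 1 =
        superChar P θ lam (1 + s) * superChar P θ lam (1 + t) := by
  intro lam _
  obtain ⟨c, hc⟩ := exists_superChar_eq_mul_patSum hP1 hP2 θ lam
  rw [hc u, hc 1, hc (1 + s), hc (1 + t), hsum, sub_self, add_sub_cancel_left,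
    add_sub_cancel_left, mul_mul_mul_comm c, mul_mul_mul_comm c (patSum P θ lam s),
    patSum_add_mul_patSum_zero θ lam s t hrow hcol]
  · simpa using ht
  · simpa using hs
  · simp
  · intro i j hij
    rw [hsum, Matrix.add_apply, hs i j hij, ht i j hij, add_zero]
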